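/- arXiv:1912.07623 — 4 statements merged into one kernel-verified Lean document; each statement's English description precedes it below -/
import Mathlib

section
/- Let g : ℝ² → ℝ be continuous, supported in the closed ball of radius a centered at the origin, and satisfy ∫_{ℝ²} g = 0. Set d = ∫_{ℝ²} x' g(x') dx' ∈ ℝ². Then there exists a constant C (depending on g and a) such that for all x with |x| ≥ 2a, | −(1/2π) ∫_{ℝ²} ln|x − x'| g(x') dx' − (1/2π)·(x·d)/|x|² | ≤ C/|x|². That is, the logarithmic potential of a compactly supported neutral charge distribution equals its dipole term up to an O(|x|^{−2}) remainder. -/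
/-- Second-order Taylor bound for `log ‖x - y‖` when `‖y‖ ≤ a ≤ ‖x‖ / 2`. -/
lemma abs_log_norm_sub_sub_dipole_le {E : Type*} [NormedAddCommGroup E] [InnerProductSpace ℝ E]
    {a : ℝ} (ha : 0 < a) {x y : E} (hx : 2 * a ≤ ‖x‖) (hy : ‖y‖ ≤ a) :
    |Real.log ‖x - y‖ - Real.log ‖x‖ + inner ℝ x y / ‖x‖ ^ 2| ≤ 19 * a ^ 2 / ‖x‖ ^ 2 := by
  have hR : 0 < ‖x‖ := by linarith
  have hlow : ‖x‖ / 2 ≤ ‖x - y‖ := by linarith [norm_sub_norm_le x y]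
  have hpos : 0 < ‖x - y‖ := by linarith
  have hsq := norm_sub_sq_real x y
  have hin := abs_le.1 (abs_real_inner_le_norm x y)
  generalize inner ℝ x y = p at *
  have hy0 := norm_nonneg y
  generalize ‖x‖ = R at *
  generalize ‖y‖ = r at *
  generalize ‖x - y‖ = s at *
  have hR2 : 0 < R ^ 2 := by positivity
  set w := s ^ 2 / R ^ 2 with hw
  have hwpos : 0 < w := by positivity
  have hw4 : 1 / 4 ≤ w := by
    rw [hw, le_div_iff₀ hR2]; nlinarith
  have hlog : Real.log s - Real.log R = Real.log w / 2 := by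
    rw [hw, Real.log_div (by positivity) (by positivity), Real.log_pow, Real.log_pow]
    push_cast; ring
  have hup := Real.log_le_sub_one_of_pos hwpos
  have hlo := Real.one_sub_inv_le_log_of_pos hwpos
  have hinv : (w - 1) - 4 * (w - 1) ^ 2 ≤ 1 - w⁻¹ := by
    have h : 1 - w⁻¹ - ((w - 1) - 4 * (w - 1) ^ 2) = (w - 1) ^ 2 * (4 * w - 1) / w := by
      field_simp; ring
    have : 0 ≤ (w - 1) ^ 2 * (4 * w - 1) / w :=
      div_nonneg (mul_nonneg (sq_nonneg _) (by linarith)) hwpos.le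
    linarith
  have hw1 : w - 1 = (r ^ 2 - 2 * p) / R ^ 2 := by
    rw [hw, hsq]; field_simp; ring
  have hRr : R * r ≤ R * a := by gcongr
  have hrr : r ^ 2 ≤ a ^ 2 := by gcongr
  have habs : |w - 1| ≤ 3 * a / R := by
    rw [hw1, abs_div, abs_of_pos hR2, div_le_div_iff₀ hR2 hR]
    have h : |r ^ 2 - 2 * p| ≤ 3 * a * R := by
      rw [abs_le]; constructor <;> nlinarith
    nlinarith
  have hquad : (w - 1) ^ 2 ≤ 9 * a ^ 2 / R ^ 2 := by
    calc (w - 1) ^ 2 = |w - 1| ^ 2 := (sq_abs _).symm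
      _ ≤ (3 * a / R) ^ 2 := by gcongr
      _ = 9 * a ^ 2 / R ^ 2 := by ring
  have hp : p / R ^ 2 = (r ^ 2 / R ^ 2 - (w - 1)) / 2 := by rw [hw1]; ring
  have hr : r ^ 2 / R ^ 2 ≤ a ^ 2 / R ^ 2 := by gcongr
  have hr0 : 0 ≤ r ^ 2 / R ^ 2 := by positivity
  rw [mul_div_assoc] at hquad ⊢
  rw [hlog, hp, abs_le]
  constructor <;> linarith


open MeasureTheory Real
open scoped RealInnerProductSpace

noncomputable section

/-- The plane `ℝ²`. -/
abbrev V2 : Type := EuclideanSpace ℝ (Fin 2)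

/-- Partial derivative in the `i`-th coordinate direction. -/
def pd (i : Fin 2) (f : V2 → ℝ) (x : V2) : ℝ :=
  fderiv ℝ f x (EuclideanSpace.single i 1)


/-- The logarithmic potential of a compactly supported, neutral
(`∫ g = 0`) charge distribution equals its dipole term up to an `O(|x|⁻²)` remainder:
for `d = ∫ x' g(x') dx'` there is `C` with
`|-(1/2π) ∫ ln|x-x'| g(x') dx' - (1/2π)(x·d)/|x|²| ≤ C/|x|²` whenever `|x| ≥ 2a`. -/
theorem stmt5 (g : V2 → ℝ) (a : ℝ) (ha : 0 < a)
    (hgc : Continuous g)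
    (hsupp : Function.support g ⊆ Metric.closedBall (0 : V2) a)
    (hneutral : (∫ x : V2, g x) = 0) :
    ∃ C : ℝ, ∀ x : V2, 2 * a ≤ ‖x‖ →
      |(-(1 / (2 * π)) * ∫ x' : V2, Real.log ‖x - x'‖ * g x') -
          (1 / (2 * π)) * ⟪x, ∫ x' : V2, g x' • x'⟫ / ‖x‖ ^ 2| ≤ C / ‖x‖ ^ 2 := by
  have hgs : HasCompactSupport g := HasCompactSupport.intro (isCompact_closedBall (0 : V2) a)
    fun x hx => by_contra fun h => hx (hsupp h)
  have hgi : Integrable g := hgc.integrable_of_hasCompactSupport hgs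
  have hdi : Integrable fun y : V2 => g y • y :=
    (hgc.smul continuous_id).integrable_of_hasCompactSupport hgs.smul_right
  refine ⟨(1 / (2 * π)) * (19 * a ^ 2 * ∫ y, |g y|), fun x hx => ?_⟩
  set F : V2 → ℝ := fun y =>
    (Real.log ‖x - y‖ - Real.log ‖x‖ + ⟪x, y⟫ / ‖x‖ ^ 2) * g y with hF
  have hbound : ∀ y, ‖F y‖ ≤ 19 * a ^ 2 / ‖x‖ ^ 2 * |g y| := fun y => by
    by_cases hy : g y = 0
    · simp [hF, hy]
    · rw [hF, Real.norm_eq_abs, abs_mul]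
      gcongr
      exact abs_log_norm_sub_sub_dipole_le ha hx (by simpa using hsupp hy)
  have hFm : Measurable F := by
    have := hgc.measurable
    have h2 : Measurable fun y : V2 => ⟪x, y⟫ := by
      have : Continuous fun y : V2 => ⟪x, y⟫ := by fun_prop
      exact this.measurable
    fun_prop
  have hbi : Integrable fun y => 19 * a ^ 2 / ‖x‖ ^ 2 * |g y| := hgi.abs.const_mul _
  have hFi : Integrable F := hbi.mono' hFm.aestronglyMeasurable (.of_forall hbound)
  have hFle : |∫ y, F y| ≤ 19 * a ^ 2 / ‖x‖ ^ 2 * ∫ y, |g y| := by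
    rw [← integral_const_mul]
    exact norm_integral_le_of_norm_le hbi (.of_forall hbound)
  have hsplit : ∫ y, Real.log ‖x - y‖ * g y
      = (∫ y, F y) - ⟪x, ∫ y, g y • y⟫ / ‖x‖ ^ 2 := by
    have hpt : (fun y => Real.log ‖x - y‖ * g y) =
        fun y => F y + Real.log ‖x‖ * g y - ⟪x, g y • y⟫ / ‖x‖ ^ 2 := by
      funext y
      simp only [hF, real_inner_smul_right]
      ring
    have hsum : Integrable fun y => F y + Real.log ‖x‖ * g y := hFi.add (hgi.const_mul _)
    rw [hpt, integral_sub hsum ((hdi.const_inner x).div_const _),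
      integral_add hFi (hgi.const_mul _), integral_const_mul, hneutral, integral_div,
      integral_inner hdi]
    ring
  rw [hsplit]
  have hπ : 0 < 1 / (2 * π) := by positivity
  calc |_| = 1 / (2 * π) * |∫ y, F y| := by
        rw [← abs_of_pos hπ, ← abs_mul, ← abs_neg, abs_of_pos hπ]
        congr 1
        ring
    _ ≤ 1 / (2 * π) * (19 * a ^ 2 / ‖x‖ ^ 2 * ∫ y, |g y|) := by gcongr
    _ = _ := by ring
end
end

section
/- Let h : ℝ² → ℝ be a C² function supported in the closed ball of radius a centered at the origin, and let α, β ∈ {1,2}. Then there exists a constant C (depending on h and a) such that for all x with |x| ≥ 2a, | ∫_{ℝ²} ln|x − x'| (∂'_α ∂'_β h)(x') dx' | ≤ C/|x|². That is, sources given by second derivatives of compactly supported functions contribute to the logarithmic potential only at quadrupole order O(|x|^{−2}). -/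
open MeasureTheory Real
open scoped RealInnerProductSpace

noncomputable section

theorem pd_contDiff {n : WithTop ℕ∞} {f : V2 → ℝ} (hf : ContDiff ℝ (n + 1) f) (i : Fin 2) :
    ContDiff ℝ n (pd i f) :=
  (hf.fderiv_right le_rfl).clm_apply contDiff_const

theorem pd_tsupport_subset (f : V2 → ℝ) (i : Fin 2) : tsupport (pd i f) ⊆ tsupport f := by
  refine closure_minimal (fun x hx => ?_) (isClosed_tsupport f)
  refine support_fderiv_subset ℝ fun h0 => hx ?_
  simp [pd, h0]

theorem pd_hasCompactSupport {f : V2 → ℝ} (hf : HasCompactSupport f) (i : Fin 2) :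
    HasCompactSupport (pd i f) :=
  hf.of_isClosed_subset (isClosed_tsupport _) (pd_tsupport_subset f i)

/-- Integration by parts of an affine function against a partial derivative. -/
theorem integral_affine_mul_pd {f : V2 → ℝ} (hf : ContDiff ℝ 1 f) (hc : HasCompactSupport f)
    (i : Fin 2) (c : ℝ) (w : V2) :
    ∫ y, (c + ⟪w, y⟫) * pd i f y = -(⟪w, EuclideanSpace.single i 1⟫ * ∫ y, f y) := by
  have hpd : Continuous (pd i f) := (pd_contDiff (n := 0) (by simpa using hf) i).continuous
  have hpc := pd_hasCompactSupport hc i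
  have hL : ∀ y : V2, HasFDerivAt (fun y : V2 => c + ⟪w, y⟫) (innerSL ℝ w) y := fun y =>
    ((innerSL ℝ w).hasFDerivAt (x := y)).const_add c
  have key := integral_mul_fderiv_eq_neg_fderiv_mul_of_integrable (μ := (volume : Measure V2))
    (f := fun y : V2 => c + ⟪w, y⟫) (g := f) (v := EuclideanSpace.single i 1) ?_ ?_ ?_
    (fun y _ => (hL y).differentiableAt) (fun y _ => hf.differentiable one_ne_zero y)
  · simp only [(hL _).fderiv, innerSL_apply_apply] at key
    rw [← integral_const_mul]
    exact key
  · simp only [(hL _).fderiv]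
    exact (hf.continuous.integrable_of_hasCompactSupport hc).const_mul _
  · exact Continuous.integrable_of_hasCompactSupport (by fun_prop) (hpc.mul_left)
  · exact Continuous.integrable_of_hasCompactSupport
      (Continuous.mul (by fun_prop) hf.continuous) (hc.mul_left)

theorem integral_pd_eq_zero {f : V2 → ℝ} (hf : ContDiff ℝ 1 f) (hc : HasCompactSupport f)
    (i : Fin 2) : ∫ y, pd i f y = 0 := by
  simpa using integral_affine_mul_pd hf hc i 1 0

theorem abs_log_one_add_sub_le {t : ℝ} (ht : -(3 / 4) ≤ t) : |log (1 + t) - t| ≤ 4 * t ^ 2 := by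
  have h1 : 0 < 1 + t := by linarith
  have hu := log_le_sub_one_of_pos h1
  have hl := one_sub_inv_le_log_of_pos h1
  have h2 : t - 4 * t ^ 2 ≤ 1 - (1 + t)⁻¹ := by
    have : 1 - (1 + t)⁻¹ - (t - 4 * t ^ 2) = t ^ 2 * (3 + 4 * t) / (1 + t) := by
      field_simp
      ring
    have : 0 ≤ t ^ 2 * (3 + 4 * t) / (1 + t) :=
      div_nonneg (mul_nonneg (sq_nonneg t) (by linarith)) h1.le
    linarith
  rw [abs_le]
  constructor <;> nlinarith [sq_nonneg t]

/-- First-order multipole expansion of the logarithm, with its remainder. -/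
theorem abs_log_norm_sub_le {x y : V2} {a : ℝ} (ha : 0 < a) (hx : 2 * a ≤ ‖x‖) (hy : ‖y‖ ≤ a) :
    |log ‖x - y‖ - (log ‖x‖ + ⟪-(‖x‖ ^ 2)⁻¹ • x, y⟫)| ≤ 13 * a ^ 2 / ‖x‖ ^ 2 := by
  have hX : 0 < ‖x‖ := by linarith
  have hY := norm_nonneg y
  obtain ⟨hin1, hin2⟩ := abs_le.1 (abs_real_inner_le_norm x y)
  have hxy : ‖x‖ / 2 ≤ ‖x - y‖ := by linarith [norm_sub_norm_le x y]
  have hpos : 0 < ‖x - y‖ := by linarith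
  have hsq := norm_sub_sq_real x y
  rw [real_inner_smul_left]
  set X := ‖x‖
  set Y := ‖y‖
  set p := ⟪x, y⟫
  set t := (Y ^ 2 - 2 * p) / X ^ 2 with ht
  have h1t : 1 + t = ‖x - y‖ ^ 2 / X ^ 2 := by
    rw [hsq, ht]
    field_simp
    ring
  have htl : -(3 / 4) ≤ t := by
    have : (1 / 4 : ℝ) ≤ ‖x - y‖ ^ 2 / X ^ 2 := by
      rw [le_div_iff₀ (by positivity)]
      nlinarith
    linarith
  have hlog : log (1 + t) = 2 * log ‖x - y‖ - 2 * log X := by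
    rw [h1t, log_div (by positivity) (by positivity), log_pow, log_pow]
    norm_num
  have hta : t ^ 2 ≤ 25 / 4 * (a ^ 2 / X ^ 2) := by
    have hnum : |Y ^ 2 - 2 * p| ≤ 5 / 2 * a * X := by
      rw [abs_le]
      constructor <;> nlinarith
    have h2 : (Y ^ 2 - 2 * p) ^ 2 ≤ (5 / 2 * a * X) ^ 2 :=
      sq_le_sq' (abs_le.1 hnum).1 (abs_le.1 hnum).2
    calc t ^ 2 = (Y ^ 2 - 2 * p) ^ 2 / (X ^ 2) ^ 2 := by rw [ht, div_pow]
      _ ≤ (5 / 2 * a * X) ^ 2 / (X ^ 2) ^ 2 := by gcongr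
      _ = 25 / 4 * (a ^ 2 / X ^ 2) := by
        field_simp
        ring
  have hYa : Y ^ 2 / X ^ 2 ≤ a ^ 2 / X ^ 2 := by gcongr
  have hY0 : 0 ≤ Y ^ 2 / X ^ 2 := by positivity
  have hp : -(X ^ 2)⁻¹ * p = (t - Y ^ 2 / X ^ 2) / 2 := by
    rw [ht]
    field_simp
    ring
  obtain ⟨hb1, hb2⟩ := abs_le.1 (abs_log_one_add_sub_le htl)
  rw [hp, mul_div_assoc, abs_le]
  constructor <;> linarith

/-- Sources given by second derivatives of a compactly supported C²
function contribute to the logarithmic potential only at quadrupole order `O(|x|⁻²)`: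
`|∫ ln|x-x'| (∂'_α ∂'_β h)(x') dx'| ≤ C/|x|²` for `|x| ≥ 2a`. -/
theorem stmt6 (h : V2 → ℝ) (a : ℝ) (ha : 0 < a) (hh : ContDiff ℝ 2 h)
    (hsupp : Function.support h ⊆ Metric.closedBall (0 : V2) a) (α β : Fin 2) :
    ∃ C : ℝ, ∀ x : V2, 2 * a ≤ ‖x‖ →
      |∫ x' : V2, Real.log ‖x - x'‖ * pd α (pd β h) x'| ≤ C / ‖x‖ ^ 2 := by
  have hts : tsupport h ⊆ Metric.closedBall (0 : V2) a :=
    closure_minimal hsupp Metric.isClosed_closedBall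
  have hc : HasCompactSupport h :=
    (isCompact_closedBall (0 : V2) a).of_isClosed_subset (isClosed_tsupport h) hts
  have hβ : ContDiff ℝ 1 (pd β h) := pd_contDiff (by simpa [one_add_one_eq_two] using hh) β
  have hβc := pd_hasCompactSupport hc β
  set g := pd α (pd β h) with hg
  have hgcont : Continuous g := (pd_contDiff (n := 0) (by simpa using hβ) α).continuous
  have hgc : HasCompactSupport g := pd_hasCompactSupport hβc α
  have hgi : Integrable g := hgcont.integrable_of_hasCompactSupport hgc
  refine ⟨13 * a ^ 2 * ∫ y, |g y|, fun x hx => ?_⟩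
  set L : V2 → ℝ := fun y => log ‖x‖ + ⟪-(‖x‖ ^ 2)⁻¹ • x, y⟫ with hL
  have hLi : Integrable fun y => L y * g y :=
    Continuous.integrable_of_hasCompactSupport (by fun_prop) hgc.mul_left
  have hL0 : ∫ y, L y * g y = 0 := by
    rw [hL, hg, integral_affine_mul_pd hβ hβc,
      integral_pd_eq_zero (hh.of_le one_le_two) hc, mul_zero, neg_zero]
  have hbound : ∀ y, ‖(log ‖x - y‖ - L y) * g y‖ ≤ 13 * a ^ 2 / ‖x‖ ^ 2 * |g y| := by
    intro y
    rw [norm_mul, norm_eq_abs, norm_eq_abs]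
    by_cases hy : g y = 0
    · simp [hy]
    · have : y ∈ Metric.closedBall (0 : V2) a :=
        hts (pd_tsupport_subset h β (pd_tsupport_subset _ α (subset_tsupport _ hy)))
      gcongr
      exact abs_log_norm_sub_le ha hx (mem_closedBall_zero_iff.1 this)
  have hRi : Integrable fun y => (log ‖x - y‖ - L y) * g y := by
    refine (hgi.abs.const_mul _).mono' ?_ (.of_forall hbound)
    have hgm := hgcont.measurable
    exact Measurable.aestronglyMeasurable (by fun_prop)
  have hsplit : ∫ y, log ‖x - y‖ * g y = ∫ y, (log ‖x - y‖ - L y) * g y := by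
    rw [← add_zero (∫ y, (log ‖x - y‖ - L y) * g y), ← hL0, ← integral_add hRi hLi]
    congr 1 with y
    ring
  rw [hsplit, mul_div_right_comm, ← integral_const_mul]
  exact norm_integral_le_of_norm_le (hgi.abs.const_mul _) (.of_forall hbound)
end
end

section
/- Let U : [0, ∞) → ℝ be C² with U' supported in [0, R] and U'(0) = 0, and let C : ℝ² × ℝ² → ℝ be smooth, bounded with bounded first derivatives, and symmetric: C(a, b) = C(b, a) for all a, b. Define the Irving–Kirkwood stress tensor σ(x) = (1/2) ∫_{ℝ²} (x' ⊗ x' / |x'|) U'(|x'|) [ ∫₀¹ C(x + (1−λ)x', x − λx') dλ ] dx'. Then for every x ∈ ℝ², div σ(x) = −∫_{ℝ²} C(x, x') ∇_x U(|x − x'|) dx', i.e. the divergence of the Irving–Kirkwood stress equals minus the pair interaction force density. -/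
open MeasureTheory Real
open scoped RealInnerProductSpace

noncomputable section

/-- The potential's derivative composed with the norm is continuous. -/
lemma continuous_derivWithin_norm {U : ℝ → ℝ} (hU : ContDiffOn ℝ 2 U (Set.Ici 0)) :
    Continuous fun z : V2 => derivWithin U (Set.Ici 0) ‖z‖ :=
  (hU.continuousOn_derivWithin (uniqueDiffOn_Ici 0) (by norm_num)).comp_continuous
    continuous_norm fun z => norm_nonneg z

section segment

variable {E : Type*} [NormedAddCommGroup E] [NormedSpace ℝ E]

/-- The derivative at `x` of `x ↦ f (x + (1 - l) • z, x - l • z)`. -/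
def segmentFDeriv (f : E × E → ℝ) (z x : E) (l : ℝ) : E →L[ℝ] ℝ :=
  (fderiv ℝ f (x + (1 - l) • z, x - l • z)).comp
    ((ContinuousLinearMap.id ℝ E).prod (ContinuousLinearMap.id ℝ E))

lemma continuous_segmentFDeriv {f : E × E → ℝ} (hf : ContDiff ℝ 1 f) (x : E) :
    Continuous fun p : E × ℝ => segmentFDeriv f p.1 x p.2 := by
  have h := hf.continuous_fderiv one_ne_zero
  unfold segmentFDeriv
  fun_prop

lemma norm_segmentFDeriv_le {f : E × E → ℝ} {M : ℝ} (hM : ∀ q, ‖fderiv ℝ f q‖ ≤ M)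
    (z x : E) (l : ℝ) : ‖segmentFDeriv f z x l‖ ≤ M := by
  have hM0 : 0 ≤ M := (norm_nonneg _).trans (hM 0)
  refine (segmentFDeriv f z x l).opNorm_le_bound hM0 fun v => ?_
  refine ((fderiv ℝ f (x + (1 - l) • z, x - l • z)).le_of_opNorm_le (hM _) (v, v)).trans ?_
  simp [Prod.norm_def]

lemma hasFDerivAt_segment {f : E × E → ℝ} (hf : ContDiff ℝ 1 f) (z x : E) (l : ℝ) :
    HasFDerivAt (fun y => f (y + (1 - l) • z, y - l • z)) (segmentFDeriv f z x l) x :=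
  ((hf.differentiable one_ne_zero).differentiableAt.hasFDerivAt).comp x
    (((hasFDerivAt_id x).add_const _).prodMk ((hasFDerivAt_id x).sub_const _))

lemma hasFDerivAt_integral_segment {f : E × E → ℝ} (hf : ContDiff ℝ 1 f) {M : ℝ}
    (hM : ∀ q, ‖fderiv ℝ f q‖ ≤ M) (z x : E) :
    HasFDerivAt (fun y => ∫ l in (0 : ℝ)..1, f (y + (1 - l) • z, y - l • z))
      (∫ l in (0 : ℝ)..1, segmentFDeriv f z x l) x := by
  have hfc := hf.continuous
  have hD : Continuous fun l => segmentFDeriv f z x l :=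
    (continuous_segmentFDeriv hf x).comp (by fun_prop : Continuous fun l : ℝ => (z, l))
  have hF (y : E) : Continuous fun l : ℝ => f (y + (1 - l) • z, y - l • z) := by fun_prop
  exact (intervalIntegral.hasFDerivAt_integral_of_dominated_of_fderiv_le
    (bound := fun _ => M) Filter.univ_mem
    (.of_forall fun y => (hF y).aestronglyMeasurable)
    ((hF x).intervalIntegrable _ _) hD.aestronglyMeasurable
    (.of_forall fun l _ y _ => norm_segmentFDeriv_le hM z y l)
    intervalIntegrable_const
    (.of_forall fun l _ y _ => hasFDerivAt_segment hf z y l))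

/-- Along the segment, the derivative in the direction of the segment integrates to the
difference of the endpoint values. -/
lemma integral_segmentFDeriv_apply_self {f : E × E → ℝ} (hf : ContDiff ℝ 1 f) (z x : E) :
    (∫ l in (0 : ℝ)..1, segmentFDeriv f z x l) z = f (x + z, x) - f (x, x - z) := by
  have hD : Continuous fun l => segmentFDeriv f z x l :=
    (continuous_segmentFDeriv hf x).comp (by fun_prop : Continuous fun l : ℝ => (z, l))
  rw [ContinuousLinearMap.intervalIntegral_apply (hD.intervalIntegrable _ _)]
  have hd (l : ℝ) : HasDerivAt (fun l : ℝ => -f (x + (1 - l) • z, x - l • z))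
      (segmentFDeriv f z x l z) l := by
    have h1 : HasDerivAt (fun l : ℝ => x + (1 - l) • z) (-z) l := by
      simpa using ((((hasDerivAt_id l).const_sub 1).smul_const z).const_add x)
    have h2 : HasDerivAt (fun l : ℝ => x - l • z) (-z) l := by
      simpa using (((hasDerivAt_id l).smul_const z).const_sub x)
    have h := (((hf.differentiable one_ne_zero).differentiableAt
      (x := (x + (1 - l) • z, x - l • z))).hasFDerivAt.comp_hasDerivAt l (h1.prodMk h2)).neg
    have h3 : ((-z, -z) : E × E) = -(z, z) := rfl
    rw [h3, map_neg, neg_neg] at h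
    exact h
  rw [intervalIntegral.integral_eq_sub_of_hasDerivAt (fun l _ => hd l)
    ((hD.clm_apply continuous_const).intervalIntegrable _ _)]
  simp
  ring

/-- Differentiation under the integral of a weighted family of segment averages. -/
lemma hasFDerivAt_integral_weighted_segment [MeasurableSpace E] [BorelSpace E]
    [SecondCountableTopology E] {μ : Measure E} {k : E → ℝ} (hk : Integrable k μ)
    {f : E × E → ℝ} (hf : ContDiff ℝ 1 f) {K M : ℝ}
    (hK : ∀ q, |f q| ≤ K) (hM : ∀ q, ‖fderiv ℝ f q‖ ≤ M) (x : E) :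
    Integrable (fun z => k z • ∫ l in (0 : ℝ)..1, segmentFDeriv f z x l) μ ∧
    HasFDerivAt (fun y => ∫ z, k z * (∫ l in (0 : ℝ)..1, f (y + (1 - l) • z, y - l • z)) ∂μ)
      (∫ z, k z • (∫ l in (0 : ℝ)..1, segmentFDeriv f z x l) ∂μ) x := by
  have hfc := hf.continuous
  have hF (y : E) : Continuous fun z => ∫ l in (0 : ℝ)..1, f (y + (1 - l) • z, y - l • z) :=
    intervalIntegral.continuous_parametric_intervalIntegral_of_continuous'
      (by fun_prop) _ _
  have hD : Continuous fun z => ∫ l in (0 : ℝ)..1, segmentFDeriv f z x l :=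
    intervalIntegral.continuous_parametric_intervalIntegral_of_continuous'
      (continuous_segmentFDeriv hf x) _ _
  have hDb (z y : E) : ‖∫ l in (0 : ℝ)..1, segmentFDeriv f z y l‖ ≤ M := by
    simpa using intervalIntegral.norm_integral_le_of_norm_le_const (a := (0 : ℝ)) (b := 1)
      fun l _ => norm_segmentFDeriv_le hM z y l
  have hFb (z y : E) : ‖∫ l in (0 : ℝ)..1, f (y + (1 - l) • z, y - l • z)‖ ≤ K := by
    simpa using intervalIntegral.norm_integral_le_of_norm_le_const (a := (0 : ℝ)) (b := 1)
      (f := fun l : ℝ => f (y + (1 - l) • z, y - l • z)) fun l _ => hK _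
  have hDm : AEStronglyMeasurable (fun z => k z • ∫ l in (0 : ℝ)..1, segmentFDeriv f z x l) μ :=
    hk.aestronglyMeasurable.smul hD.aestronglyMeasurable
  have hbound (z y : E) : ‖k z • ∫ l in (0 : ℝ)..1, segmentFDeriv f z y l‖ ≤ ‖k z‖ * M := by
    rw [norm_smul]
    exact mul_le_mul_of_nonneg_left (hDb z y) (norm_nonneg _)
  refine ⟨(hk.norm.mul_const M).mono' hDm (.of_forall fun z => hbound z x), ?_⟩
  exact hasFDerivAt_integral_of_dominated_of_fderiv_le
    (bound := fun z => ‖k z‖ * M) Filter.univ_mem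
    (.of_forall fun y => hk.aestronglyMeasurable.mul (hF y).aestronglyMeasurable)
    (hk.mul_bdd (hF x).aestronglyMeasurable (.of_forall fun z => hFb z x)) hDm
    (.of_forall fun z y _ => hbound z y) (hk.norm.mul_const M)
    (.of_forall fun z y _ => (hasFDerivAt_integral_segment hf hM z y).const_mul (k z))

end segment

/-- A bounded weight times a compactly supported radial force is integrable. -/
lemma integrable_mul_derivWithin_norm {U : ℝ → ℝ} {R : ℝ} (hU : ContDiffOn ℝ 2 U (Set.Ici 0))
    (hR : ∀ r : ℝ, R ≤ r → derivWithin U (Set.Ici 0) r = 0) {w : V2 → ℝ} (hw : Measurable w)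
    (hwb : ∀ z, |w z| ≤ 1) {p : V2 → ℝ} (hp : Continuous p) :
    Integrable fun z : V2 => w z * (p z * derivWithin U (Set.Ici 0) ‖z‖) := by
  have hc : Continuous fun z : V2 => p z * derivWithin U (Set.Ici 0) ‖z‖ :=
    hp.mul (continuous_derivWithin_norm hU)
  have hs : HasCompactSupport fun z : V2 => p z * derivWithin U (Set.Ici 0) ‖z‖ := by
    refine HasCompactSupport.intro (isCompact_closedBall 0 R) fun z hz => ?_
    rw [hR, mul_zero]
    simpa using (lt_of_not_ge (by simpa using hz)).le
  exact (hc.integrable_of_hasCompactSupport hs).bdd_mul hw.aestronglyMeasurable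
    (.of_forall hwb)

lemma abs_coord_div_norm_le (z : V2) (α : Fin 2) : |z α / ‖z‖| ≤ 1 := by
  rw [abs_div, abs_norm]
  exact div_le_one_of_le₀ (PiLp.norm_apply_le z α) (norm_nonneg _)

/-- The divergence of the Irving–Kirkwood stress tensor
`σ(x) = (1/2) ∫ (x'⊗x'/|x'|) U'(|x'|) ∫₀¹ C(x+(1-λ)x', x-λx') dλ dx'`
equals minus the pair interaction force density
`-∫ C(x,x') ∇ₓU(|x-x'|) dx'`. -/
theorem stmt12 (U : ℝ → ℝ) (R : ℝ) (hR : 0 < R)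
    (hU : ContDiffOn ℝ 2 U (Set.Ici 0))
    (hU'supp : ∀ r : ℝ, R ≤ r → derivWithin U (Set.Ici 0) r = 0)
    (hU'0 : derivWithin U (Set.Ici 0) 0 = 0)
    (C : V2 → V2 → ℝ)
    (hC : ContDiff ℝ (⊤ : ℕ∞) fun q : V2 × V2 => C q.1 q.2)
    (M : ℝ) (hCb : ∀ a b : V2, |C a b| ≤ M)
    (M' : ℝ) (hCb' : ∀ q : V2 × V2, ‖fderiv ℝ (fun q : V2 × V2 => C q.1 q.2) q‖ ≤ M')
    (hCsymm : ∀ a b : V2, C a b = C b a)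
    (σ : V2 → Fin 2 → Fin 2 → ℝ)
    (hσ : ∀ (x : V2) (α β : Fin 2), σ x α β = (1 / 2) * ∫ x' : V2,
        x' α * x' β / ‖x'‖ * derivWithin U (Set.Ici 0) ‖x'‖ *
          ∫ l in (0:ℝ)..1, C (x + (1 - l) • x') (x - l • x')) :
    ∀ (x : V2) (α : Fin 2), (∑ β, pd β (fun y => σ y α β) x) =
      -∫ x' : V2, C x x' *
        (derivWithin U (Set.Ici 0) ‖x - x'‖ * (x α - x' α) / ‖x - x'‖) := by
  intro x α
  set D : ℝ → ℝ := derivWithin U (Set.Ici 0) with hD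
  set f : V2 × V2 → ℝ := fun q => C q.1 q.2 with hf
  have hf1 : ContDiff ℝ 1 f := hC.of_le (by exact_mod_cast le_top)
  have hm (i : Fin 2) : Measurable fun z : V2 => z i / ‖z‖ := by fun_prop
  have hk (β : Fin 2) : Integrable fun z : V2 => z α * z β / ‖z‖ * D ‖z‖ := by
    refine (integrable_mul_derivWithin_norm hU hU'supp (hm α)
      (fun z => abs_coord_div_norm_le z α) (p := fun z => z β) (by fun_prop)).congr
      (.of_forall fun z => ?_)
    simp only [hD]
    ring
  have hg : Integrable fun z : V2 => z α / ‖z‖ * D ‖z‖ := by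
    simpa using integrable_mul_derivWithin_norm hU hU'supp (hm α)
      (fun z => abs_coord_div_norm_le z α) (p := fun _ => 1) (by fun_prop)
  have hder (β : Fin 2) := hasFDerivAt_integral_weighted_segment (hk β) hf1
    (fun q => hCb q.1 q.2) hCb' x
  have hpd (β : Fin 2) : pd β (fun y => σ y α β) x = (1 / 2) * ∫ z : V2,
      z α * z β / ‖z‖ * D ‖z‖ *
        (∫ l in (0 : ℝ)..1, segmentFDeriv f z x l) (EuclideanSpace.single β 1) := by
    have h : HasFDerivAt (fun y => σ y α β) _ x :=
      (((hder β).2.const_mul (1 / 2)).congr_of_eventuallyEq (.of_forall fun y => hσ y α β))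
    rw [pd, h.fderiv, smul_apply,
      ContinuousLinearMap.integral_apply (hder β).1]
    rfl
  have hint (β : Fin 2) : Integrable fun z : V2 => z α * z β / ‖z‖ * D ‖z‖ *
        (∫ l in (0 : ℝ)..1, segmentFDeriv f z x l) (EuclideanSpace.single β 1) :=
    (hder β).1.apply_continuousLinearMap _
  have hsum (z : V2) : ∑ β, z α * z β / ‖z‖ * D ‖z‖ *
        (∫ l in (0 : ℝ)..1, segmentFDeriv f z x l) (EuclideanSpace.single β 1) =
      z α / ‖z‖ * D ‖z‖ * C x (x + z) - z α / ‖z‖ * D ‖z‖ * C x (x - z) := by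
    have hz : z = ∑ β, z β • EuclideanSpace.single β (1 : ℝ) := by
      ext i
      fin_cases i <;> simp
    have h := integral_segmentFDeriv_apply_self hf1 z x
    set L := ∫ l in (0 : ℝ)..1, segmentFDeriv f z x l
    have hL : L z = ∑ β, z β * L (EuclideanSpace.single β 1) := by
      conv_lhs => rw [hz]
      simp only [map_sum, map_smul, smul_eq_mul]
    rw [← mul_sub, ← hCsymm (x + z) x, ← h, hL, Finset.mul_sum]
    exact Finset.sum_congr rfl fun β _ => by ring
  have hCc (g : V2 → V2) (hgc : Continuous g) :
      Integrable fun z : V2 => z α / ‖z‖ * D ‖z‖ * C x (g z) :=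
    hg.mul_bdd (hf1.continuous.comp
      (continuous_const.prodMk hgc : Continuous fun z => (x, g z))).aestronglyMeasurable
      (.of_forall fun z => hCb x (g z))
  have hminus : ∫ z : V2, z α / ‖z‖ * D ‖z‖ * C x (x - z) =
      ∫ y : V2, C x y * (D ‖x - y‖ * (x α - y α) / ‖x - y‖) := by
    rw [← integral_sub_left_eq_self _ volume x]
    refine integral_congr_ae (.of_forall fun y => ?_)
    simp only [sub_sub_cancel, PiLp.sub_apply]
    ring
  have hplus : ∫ z : V2, z α / ‖z‖ * D ‖z‖ * C x (x + z) =
      -∫ z : V2, z α / ‖z‖ * D ‖z‖ * C x (x - z) := by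
    rw [← integral_neg_eq_self, ← integral_neg]
    refine integral_congr_ae (.of_forall fun y => ?_)
    simp only [norm_neg, PiLp.neg_apply, ← sub_eq_add_neg]
    ring
  simp_rw [hpd]
  rw [← Finset.mul_sum, ← integral_finsetSum _ fun β _ => hint β]
  simp_rw [hsum]
  rw [integral_sub (hCc _ (by fun_prop)) (hCc _ (by fun_prop)), hplus, hminus]
  ring
end
end

section
/- Let p ∈ ℝ², c ∈ ℝ, R₀ > 0, C₀ > 0, and let σ : ℝ² → ℝ^{2×2} be continuous and satisfy, for all |x| ≥ R₀, σ(x) = [ c − (1/2π)·(x·p)/|x|² ]·𝟙 + h(x) with ‖h(x)‖ ≤ C₀/|x|². Then for all R ≥ R₀, the outward flux of σ through the circle of radius R satisfies ‖ ∮_{|x| = R} σ(x)·n(x) dℓ(x) + p/2 ‖ ≤ 2πC₀/R, where n(x) = x/|x| is the outward unit normal and dℓ is arclength. In particular ∮_{|x|=R} σ·n dℓ → −p/2 as R → ∞, which is the origin of the factor 1/2 in the disk-limited current–force relation ∫_{D_R} J = (μ/2) p + O(R^{−1}). -/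
open MeasureTheory Real
open scoped RealInnerProductSpace

noncomputable section

/-- The point at angle `θ` on the circle of radius `R` about the origin. -/
def circlePt (R θ : ℝ) : V2 :=
  (WithLp.equiv 2 (Fin 2 → ℝ)).symm ![R * Real.cos θ, R * Real.sin θ]

/-- The outward unit normal direction at angle `θ`. -/
def circleDir (θ : ℝ) : Fin 2 → ℝ := ![Real.cos θ, Real.sin θ]

theorem norm_circlePt {R : ℝ} (hR : 0 ≤ R) (θ : ℝ) : ‖circlePt R θ‖ = R := by
  rw [EuclideanSpace.norm_eq, Real.sqrt_eq_iff_eq_sq (by positivity) hR]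
  simp only [circlePt, Fin.sum_univ_two, norm_eq_abs, sq_abs]
  simp
  linear_combination R ^ 2 * Real.sin_sq_add_cos_sq θ

theorem inner_circlePt (R θ : ℝ) (p : V2) :
    ⟪circlePt R θ, p⟫ = R * (Real.cos θ * p 0 + Real.sin θ * p 1) := by
  simp only [PiLp.inner_apply, Fin.sum_univ_two, circlePt]
  simp
  ring

theorem continuous_circlePt (R : ℝ) : Continuous (circlePt R) := by
  refine (PiLp.continuous_toLp 2 _).comp (continuous_pi fun i => ?_)
  fin_cases i <;> simp <;> fun_prop

/-- The Euclidean norm of the integral of a planar vector field is at most the length of the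
interval times a pointwise bound for the norm. -/
theorem sqrt_integral_sq_add_sq_le {f g : ℝ → ℝ} (hf : Continuous f) (hg : Continuous g)
    {a b M : ℝ} (hM : ∀ t, Real.sqrt (f t ^ 2 + g t ^ 2) ≤ M) :
    Real.sqrt ((∫ t in a..b, f t) ^ 2 + (∫ t in a..b, g t) ^ 2) ≤ M * |b - a| := by
  have key : ∫ t in a..b, ((f t : ℂ) + g t * Complex.I)
      = ((∫ t in a..b, f t : ℝ) : ℂ) + ((∫ t in a..b, g t : ℝ) : ℂ) * Complex.I := by
    rw [intervalIntegral.integral_add, intervalIntegral.integral_mul_const,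
      intervalIntegral.integral_ofReal, intervalIntegral.integral_ofReal]
    · exact Continuous.intervalIntegrable (by fun_prop) _ _
    · exact Continuous.intervalIntegrable (by fun_prop) _ _
  rw [← Complex.norm_add_mul_I, ← key]
  refine intervalIntegral.norm_integral_le_of_norm_le_const fun t _ => ?_
  rw [Complex.norm_add_mul_I]
  exact hM t

theorem sqrt_mulVec_circleDir_le (A : Fin 2 → Fin 2 → ℝ) (θ : ℝ) :
    Real.sqrt ((∑ β, A 0 β * circleDir θ β) ^ 2 + (∑ β, A 1 β * circleDir θ β) ^ 2) ≤
      Real.sqrt (∑ α, ∑ β, A α β ^ 2) := by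
  apply Real.sqrt_le_sqrt
  have row (u v : ℝ) : (u * Real.cos θ + v * Real.sin θ) ^ 2 ≤ u ^ 2 + v ^ 2 := by
    have := sq_nonneg (u * Real.sin θ - v * Real.cos θ)
    linear_combination this + (u ^ 2 + v ^ 2) * Real.sin_sq_add_cos_sq θ
  simp only [Fin.sum_univ_two, circleDir, Matrix.cons_val_zero, Matrix.cons_val_one]
  exact add_le_add (row _ _) (row _ _)

theorem integral_inner_circleDir_mul (a b k : ℝ) (α : Fin 2) :
    ∫ θ in (0:ℝ)..(2 * π),
      (k - (1 / (2 * π)) * (Real.cos θ * a + Real.sin θ * b)) * circleDir θ α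
      = -(![a, b] α) / 2 := by
  have hcc : ∫ θ in (0:ℝ)..(2 * π), Real.cos θ ^ 2 = π := by
    rw [integral_cos_sq]; simp
  have hss : ∫ θ in (0:ℝ)..(2 * π), Real.sin θ ^ 2 = π := by
    rw [integral_sin_sq]; simp
  have hsc : ∫ θ in (0:ℝ)..(2 * π), Real.sin θ * Real.cos θ = 0 := by
    rw [integral_sin_mul_cos₁]; simp
  have hc : ∫ θ in (0:ℝ)..(2 * π), Real.cos θ = 0 := by simp
  have hs : ∫ θ in (0:ℝ)..(2 * π), Real.sin θ = 0 := by simp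
  have combine (x y z : ℝ) {f g h : ℝ → ℝ} (hf : Continuous f) (hg : Continuous g)
      (hh : Continuous h) :
      ∫ θ in (0:ℝ)..(2 * π), (x * f θ + y * g θ + z * h θ)
        = x * (∫ θ in (0:ℝ)..(2 * π), f θ) + y * (∫ θ in (0:ℝ)..(2 * π), g θ)
          + z * ∫ θ in (0:ℝ)..(2 * π), h θ := by
    rw [intervalIntegral.integral_add, intervalIntegral.integral_add,
      intervalIntegral.integral_const_mul, intervalIntegral.integral_const_mul,
      intervalIntegral.integral_const_mul] <;>
    exact Continuous.intervalIntegrable (by fun_prop) _ _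
  have hπ := Real.pi_ne_zero
  fin_cases α
  · have h := combine k (-(a / (2 * π))) (-(b / (2 * π))) Real.continuous_cos
      (Real.continuous_cos.pow 2) (Real.continuous_sin.mul Real.continuous_cos)
    simp only [Pi.pow_apply, Pi.mul_apply, hc, hcc, hsc] at h
    simp only [circleDir, Fin.zero_eta, Matrix.cons_val_zero]
    convert h using 1
    · congr 1; funext θ; ring
    · field_simp; ring
  · have h := combine k (-(b / (2 * π))) (-(a / (2 * π))) Real.continuous_sin
      (Real.continuous_sin.pow 2) (Real.continuous_sin.mul Real.continuous_cos)
    simp only [Pi.pow_apply, Pi.mul_apply, hs, hss, hsc] at h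
    simp only [circleDir, Fin.mk_one, Matrix.cons_val_one, Matrix.cons_val_zero]
    convert h using 1
    · congr 1; funext θ; ring
    · field_simp; ring

/-- If `σ(x) = [c - (1/2π)(x·p)/|x|²]·𝟙 + h(x)` for `|x| ≥ R₀`, with
`‖h(x)‖ ≤ C₀/|x|²` (Frobenius norm), then for all `R ≥ R₀` the outward flux of `σ`
through the circle of radius `R` satisfies `‖∮ σ·n dℓ + p/2‖ ≤ 2πC₀/R`; in particular
`∮ σ·n dℓ → -p/2` as `R → ∞`. -/
theorem stmt19 (p : V2) (c R₀ C₀ : ℝ) (hR₀ : 0 < R₀) (hC₀ : 0 < C₀)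
    (σ h : V2 → Fin 2 → Fin 2 → ℝ)
    (hσc : ∀ α β, Continuous fun x => σ x α β)
    (hdecomp : ∀ x : V2, R₀ ≤ ‖x‖ → ∀ α β : Fin 2,
      σ x α β = (c - (1 / (2 * π)) * ⟪x, p⟫ / ‖x‖ ^ 2) * (if α = β then 1 else 0)
        + h x α β)
    (hhb : ∀ x : V2, R₀ ≤ ‖x‖ →
      Real.sqrt (∑ α, ∑ β, h x α β ^ 2) ≤ C₀ / ‖x‖ ^ 2) :
    ∀ R : ℝ, R₀ ≤ R →
      Real.sqrt
        (((∫ θ in (0:ℝ)..(2 * π),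
            (∑ β, σ (circlePt R θ) 0 β * circleDir θ β) * R) + p 0 / 2) ^ 2 +
         ((∫ θ in (0:ℝ)..(2 * π),
            (∑ β, σ (circlePt R θ) 1 β * circleDir θ β) * R) + p 1 / 2) ^ 2) ≤
      2 * π * C₀ / R := by
  intro R hR
  have hRpos : 0 < R := hR₀.trans_le hR
  have hnorm (θ : ℝ) : ‖circlePt R θ‖ = R := norm_circlePt hRpos.le θ
  have hle (θ : ℝ) : R₀ ≤ ‖circlePt R θ‖ := (hnorm θ).symm ▸ hR
  have hσ (θ : ℝ) (α β : Fin 2) : σ (circlePt R θ) α β =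
      (c - (1 / (2 * π)) * (R * (Real.cos θ * p 0 + Real.sin θ * p 1)) / R ^ 2)
        * (if α = β then 1 else 0) + h (circlePt R θ) α β := by
    rw [hdecomp _ (hle θ), hnorm, inner_circlePt]
  have hdir (β : Fin 2) : Continuous fun θ => circleDir θ β := by
    fin_cases β <;> simp [circleDir] <;> fun_prop
  have hh (α β : Fin 2) : Continuous fun θ => h (circlePt R θ) α β := by
    have hrem : (fun θ => h (circlePt R θ) α β) = fun θ => σ (circlePt R θ) α β -
        (c - (1 / (2 * π)) * (R * (Real.cos θ * p 0 + Real.sin θ * p 1)) / R ^ 2)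
          * (if α = β then 1 else 0) := by
      funext θ
      rw [hσ]
      ring
    rw [hrem]
    have := (hσc α β).comp (continuous_circlePt R)
    exact this.sub (by fun_prop)
  have hrow (α : Fin 2) :
      Continuous fun θ => (∑ β, h (circlePt R θ) α β * circleDir θ β) :=
    continuous_finsetSum _ fun β _ => (hh α β).mul (hdir β)
  have hflux (α : Fin 2) :
      (∫ θ in (0:ℝ)..(2 * π), (∑ β, σ (circlePt R θ) α β * circleDir θ β) * R) + p α / 2
        = R * ∫ θ in (0:ℝ)..(2 * π), ∑ β, h (circlePt R θ) α β * circleDir θ β := by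
    have hsplit : (fun θ => (∑ β, σ (circlePt R θ) α β * circleDir θ β) * R) = fun θ =>
        (c * R - (1 / (2 * π)) * (Real.cos θ * p 0 + Real.sin θ * p 1)) * circleDir θ α
          + R * ∑ β, h (circlePt R θ) α β * circleDir θ β := by
      funext θ
      simp only [hσ, add_mul, Finset.sum_add_distrib, mul_ite, ite_mul, mul_one, mul_zero,
        zero_mul, Finset.sum_ite_eq, Finset.mem_univ, if_true]
      field_simp
    have hp : ![p 0, p 1] α = p α := by fin_cases α <;> rfl
    rw [hsplit, intervalIntegral.integral_add, integral_inner_circleDir_mul,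
      intervalIntegral.integral_const_mul, hp]
    · ring
    · have := hdir α
      exact Continuous.intervalIntegrable (by fun_prop) _ _
    · exact ((hrow α).const_mul R).intervalIntegrable _ _
  rw [hflux, hflux, mul_pow, mul_pow, ← mul_add, Real.sqrt_mul (sq_nonneg R),
    Real.sqrt_sq hRpos.le]
  have hbound := sqrt_integral_sq_add_sq_le (hrow 0) (hrow 1) (a := 0) (b := 2 * π)
    fun θ => (sqrt_mulVec_circleDir_le (h (circlePt R θ)) θ).trans
      ((hhb _ (hle θ)).trans_eq (by rw [hnorm]))
  rw [sub_zero, abs_of_pos Real.two_pi_pos] at hbound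
  calc _ ≤ R * (C₀ / R ^ 2 * (2 * π)) := by gcongr
    _ = 2 * π * C₀ / R := by field_simp
end
end
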